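/- arXiv:2008.10526 — 9 statements merged into one kernel-verified Lean document; each statement's English description precedes it below -/
import Mathlib

section
/- For each 1 ≤ i ≤ T, the Fréchet derivative DF_i of the composition F_i = f_i ∘ f_{i+1} ∘ ⋯ ∘ f_T is Lipschitz continuous (as a map from E_T into the space of continuous linear maps E_T → E_{i−1} with the operator norm) with Lipschitz constant L_{∇F_i} = Σ_{j=i}^{T} L_{∇f_j} · (∏_{l=i}^{j−1} L_{f_l}) · (∏_{l=j+1}^{T} L_{f_l}²), where empty products equal 1. -/
open scoped RealInnerProductSpace
open Finset

noncomputable section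

/-- Chain of spaces: level `0` is `ℝ`, level `i ≥ 1` is `E i`. -/
def Lvl (E : ℕ → Type) : ℕ → Type
  | 0 => ℝ
  | i + 1 => E (i + 1)

instance (E : ℕ → Type) [∀ i, NormedAddCommGroup (E i)] : ∀ i, NormedAddCommGroup (Lvl E i)
  | 0 => inferInstanceAs (NormedAddCommGroup ℝ)
  | i + 1 => inferInstanceAs (NormedAddCommGroup (E (i + 1)))

instance (E : ℕ → Type) [∀ i, NormedAddCommGroup (E i)] [∀ i, InnerProductSpace ℝ (E i)] :
    ∀ i, InnerProductSpace ℝ (Lvl E i)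
  | 0 => inferInstanceAs (InnerProductSpace ℝ ℝ)
  | i + 1 => inferInstanceAs (InnerProductSpace ℝ (E (i + 1)))

instance (E : ℕ → Type) [∀ i, NormedAddCommGroup (E i)] [∀ i, InnerProductSpace ℝ (E i)]
    [∀ i, FiniteDimensional ℝ (E i)] : ∀ i, FiniteDimensional ℝ (Lvl E i)
  | 0 => inferInstanceAs (FiniteDimensional ℝ ℝ)
  | i + 1 => inferInstanceAs (FiniteDimensional ℝ (E (i + 1)))

/-- `g` is differentiable and `K`-Lipschitz, with `M`-Lipschitz derivative. -/
def HasLipschitzBounds {A B : Type*} [NormedAddCommGroup A] [NormedSpace ℝ A]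
    [NormedAddCommGroup B] [NormedSpace ℝ B] (g : A → B) (K M : ℝ) : Prop :=
  Differentiable ℝ g ∧ (∀ x y, ‖g x - g y‖ ≤ K * ‖x - y‖) ∧
    ∀ x y, ‖fderiv ℝ g x - fderiv ℝ g y‖ ≤ M * ‖x - y‖

theorem HasLipschitzBounds.id {A : Type*} [NormedAddCommGroup A] [NormedSpace ℝ A] :
    HasLipschitzBounds (id : A → A) 1 0 :=
  ⟨differentiable_id, by simp, by simp [fderiv_id]⟩

theorem HasLipschitzBounds.norm_fderiv_le {A B : Type*} [NormedAddCommGroup A] [NormedSpace ℝ A]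
    [NormedAddCommGroup B] [NormedSpace ℝ B] {g : A → B} {K M : ℝ} (hK : 0 ≤ K)
    (hg : HasLipschitzBounds g K M) (x : A) : ‖fderiv ℝ g x‖ ≤ K :=
  norm_fderiv_le_of_lip' ℝ hK (Filter.Eventually.of_forall fun y => hg.2.1 y x)

/-- Lipschitz bounds for a composition, by the chain rule. -/
theorem HasLipschitzBounds.comp {A B C : Type*} [NormedAddCommGroup A] [NormedSpace ℝ A]
    [NormedAddCommGroup B] [NormedSpace ℝ B] [NormedAddCommGroup C] [NormedSpace ℝ C]
    {g : B → C} {G : A → B} {K M K' M' : ℝ} (hK : 0 ≤ K) (hM : 0 ≤ M) (hK' : 0 ≤ K')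
    (hg : HasLipschitzBounds g K M) (hG : HasLipschitzBounds G K' M') :
    HasLipschitzBounds (g ∘ G) (K * K') (M * K' ^ 2 + K * M') := by
  refine ⟨hg.1.comp hG.1, fun x y => ?_, fun x y => ?_⟩
  · calc ‖g (G x) - g (G y)‖ ≤ K * ‖G x - G y‖ := hg.2.1 _ _
      _ ≤ K * (K' * ‖x - y‖) := by gcongr; exact hG.2.1 x y
      _ = K * K' * ‖x - y‖ := by ring
  · rw [fderiv_comp x (hg.1 _) (hG.1 x), fderiv_comp y (hg.1 _) (hG.1 y)]
    have key : (fderiv ℝ g (G x)).comp (fderiv ℝ G x) - (fderiv ℝ g (G y)).comp (fderiv ℝ G y) =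
        (fderiv ℝ g (G x) - fderiv ℝ g (G y)).comp (fderiv ℝ G x) +
          (fderiv ℝ g (G y)).comp (fderiv ℝ G x - fderiv ℝ G y) := by
      ext v; simp
    have outer : ‖fderiv ℝ g (G x) - fderiv ℝ g (G y)‖ ≤ M * (K' * ‖x - y‖) :=
      (hg.2.2 _ _).trans (mul_le_mul_of_nonneg_left (hG.2.1 x y) hM)
    rw [key]
    calc _ ≤ ‖fderiv ℝ g (G x) - fderiv ℝ g (G y)‖ * ‖fderiv ℝ G x‖ +
          ‖fderiv ℝ g (G y)‖ * ‖fderiv ℝ G x - fderiv ℝ G y‖ :=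
          (norm_add_le _ _).trans (add_le_add (ContinuousLinearMap.opNorm_comp_le _ _)
            (ContinuousLinearMap.opNorm_comp_le _ _))
      _ ≤ M * (K' * ‖x - y‖) * K' + K * (M' * ‖x - y‖) := by
          gcongr
          · exact hG.norm_fderiv_le hK' x
          · exact hg.norm_fderiv_le hK _
          · exact hG.2.2 x y
      _ = (M * K' ^ 2 + K * M') * ‖x - y‖ := by ring

theorem sum_mul_prod_mul_prod_sq_eq {T i : ℕ} (hi : i ≤ T) (K M : ℕ → ℝ) :
    ∑ j ∈ Icc i T, M j * (∏ l ∈ Ico i j, K l) * ∏ l ∈ Icc (j + 1) T, K l ^ 2 =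
      M i * (∏ l ∈ Icc (i + 1) T, K l) ^ 2 +
        K i * ∑ j ∈ Icc (i + 1) T, M j * (∏ l ∈ Ico (i + 1) j, K l) *
          ∏ l ∈ Icc (j + 1) T, K l ^ 2 := by
  rw [← insert_Icc_add_one_left_eq_Icc hi, sum_insert (by simp), mul_sum, ← prod_pow]
  congr 1
  · simp
  · refine sum_congr rfl fun j hj => ?_
    rw [prod_eq_prod_Ico_succ_bot (by simp at hj; omega)]
    ring

/-- Lemma 2.1 of the paper: the derivative of `F i = f i ∘ f (i+1) ∘ ⋯ ∘ f T` is Lipschitz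
continuous with constant `∑_{j=i}^T L∇f_j (∏_{l=i}^{j-1} L_{f_l}) (∏_{l=j+1}^T L_{f_l}²)`. -/
theorem stmt0
    (T : ℕ) (hT : 1 ≤ T)
    (E : ℕ → Type) [∀ i, NormedAddCommGroup (E i)] [∀ i, InnerProductSpace ℝ (E i)]
    [∀ i, FiniteDimensional ℝ (E i)]
    -- the maps `f i : E i → E (i-1)` for `1 ≤ i ≤ T`
    (f : ∀ i, Lvl E i → Lvl E (i - 1))
    (Lf Ldf : ℕ → ℝ)
    (hLf : ∀ i, 1 ≤ i → i ≤ T → 0 ≤ Lf i)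
    (hLdf : ∀ i, 1 ≤ i → i ≤ T → 0 ≤ Ldf i)
    (hfd : ∀ i, 1 ≤ i → i ≤ T → ContDiff ℝ 1 (f i))
    (hfLip : ∀ i, 1 ≤ i → i ≤ T → ∀ a b, ‖f i a - f i b‖ ≤ Lf i * ‖a - b‖)
    (hdfLip : ∀ i, 1 ≤ i → i ≤ T →
      ∀ a b, ‖fderiv ℝ (f i) a - fderiv ℝ (f i) b‖ ≤ Ldf i * ‖a - b‖)
    -- the compositions `F i = f i ∘ f (i+1) ∘ ⋯ ∘ f T`
    (F : ∀ i, Lvl E T → Lvl E (i - 1))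
    (hFtop : F (T + 1) = id)
    (hF : ∀ i, 1 ≤ i → i ≤ T → F i = f i ∘ F (i + 1))
    (i : ℕ) (hi1 : 1 ≤ i) (hiT : i ≤ T) :
    ∀ x y : Lvl E T,
      ‖fderiv ℝ (F i) x - fderiv ℝ (F i) y‖ ≤
        (∑ j ∈ Icc i T, Ldf j * (∏ l ∈ Ico i j, Lf l) * ∏ l ∈ Icc (j + 1) T, (Lf l) ^ 2) *
          ‖x - y‖ := by
  suffices H : ∀ k ≤ T + 1, 1 ≤ k → HasLipschitzBounds (F k) (∏ l ∈ Icc k T, Lf l)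
      (∑ j ∈ Icc k T, Ldf j * (∏ l ∈ Ico k j, Lf l) * ∏ l ∈ Icc (j + 1) T, (Lf l) ^ 2) from
    (H i (by omega) hi1).2.2
  intro k hk
  induction hk using Nat.decreasingInduction with
  | self =>
    intro _
    rw [hFtop]
    simpa using HasLipschitzBounds.id (A := Lvl E T)
  | of_succ k hk ih =>
    intro hk1
    have hkT : k ≤ T := by omega
    rw [hF k hk1 hkT, sum_mul_prod_mul_prod_sq_eq hkT,
      ← insert_Icc_add_one_left_eq_Icc hkT, prod_insert (by simp)]
    exact HasLipschitzBounds.comp (B := Lvl E k) (hLf k hk1 hkT) (hLdf k hk1 hkT)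
      (prod_nonneg fun l hl => hLf l (by simp at hl; omega) (by simp at hl; omega))
      ⟨(hfd k hk1 hkT).differentiable one_ne_zero, hfLip k hk1 hkT, hdfLip k hk1 hkT⟩
      (ih (by omega))
end
end

section
/- Fix 1 ≤ i ≤ T, a point x ∈ E_T, and points w_j ∈ E_{j−1} for j = i+1, …, T; set w_{T+1} := x. Then the operator-norm distance between the exact derivative chain and the inexact one satisfies ‖DF_i(x) − Df_i(w_{i+1}) ∘ Df_{i+1}(w_{i+2}) ∘ ⋯ ∘ Df_{T−1}(w_T) ∘ Df_T(x)‖ ≤ Σ_{j=i}^{T−1} L_{∇f_j} · (∏_{l=i, l≠j}^{T} L_{f_l}) · ‖F_{j+1}(x) − w_{j+1}‖. -/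
open scoped RealInnerProductSpace
open Finset

noncomputable section

/-- One step of the chain: the error of a product of two operators, one of them known up to an
error bounded by `ε`, the other up to an error bounded by `δ`. -/
theorem norm_comp_sub_comp_le {X Y Z : Type*} [NormedAddCommGroup X] [NormedSpace ℝ X]
    [NormedAddCommGroup Y] [NormedSpace ℝ Y] [NormedAddCommGroup Z] [NormedSpace ℝ Z]
    {A A' : Y →L[ℝ] Z} {B B' : X →L[ℝ] Y} {ε δ a b : ℝ}
    (hA : ‖A - A'‖ ≤ ε) (hB : ‖B - B'‖ ≤ δ) (hA' : ‖A'‖ ≤ a) (hb : ‖B‖ ≤ b) :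
    ‖A.comp B - A'.comp B'‖ ≤ ε * b + a * δ := by
  have h : A.comp B - A'.comp B' = (A - A').comp B + A'.comp (B - B') := by
    ext v
    simp
  have hε : 0 ≤ ε := (norm_nonneg _).trans hA
  have ha : 0 ≤ a := (norm_nonneg _).trans hA'
  rw [h]
  refine (norm_add_le _ _).trans (add_le_add ?_ ?_)
  · exact (ContinuousLinearMap.opNorm_comp_le _ _).trans (by gcongr)
  · exact (ContinuousLinearMap.opNorm_comp_le _ _).trans (by gcongr)

/-- The derivative of a Lipschitz map is bounded by the Lipschitz constant. -/
theorem norm_fderiv_le_of_norm_sub_le {X Y : Type*} [NormedAddCommGroup X] [NormedSpace ℝ X]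
    [NormedAddCommGroup Y] [NormedSpace ℝ Y] {g : X → Y} {C : ℝ} (hC : 0 ≤ C)
    (hg : ∀ a b, ‖g a - g b‖ ≤ C * ‖a - b‖) (x : X) : ‖fderiv ℝ g x‖ ≤ C :=
  norm_fderiv_le_of_lip' ℝ hC (Filter.Eventually.of_forall fun y => hg y x)

/-- The error sum over `Ico j T` splits into its first term and `Lf j` times the error sum over
`Ico (j + 1) T`. -/
theorem sum_mul_prod_erase_eq {j T : ℕ} (hj : j < T) (L D d : ℕ → ℝ) :
    ∑ k ∈ Ico j T, D k * (∏ l ∈ (Icc j T).erase k, L l) * d k =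
      D j * d j * ∏ l ∈ Icc (j + 1) T, L l +
        L j * ∑ k ∈ Ico (j + 1) T, D k * (∏ l ∈ (Icc (j + 1) T).erase k, L l) * d k := by
  rw [Finset.sum_eq_sum_Ico_succ_bot hj, Finset.mul_sum]
  congr 1
  · rw [Finset.Icc_erase_left, ← Finset.Icc_add_one_left_eq_Ioc]
    ring
  · refine Finset.sum_congr rfl fun k hk => ?_
    have hk' := Finset.mem_Ico.mp hk
    have h : (Icc j T).erase k = insert j ((Icc (j + 1) T).erase k) := by
      ext l
      simp only [Finset.mem_erase, Finset.mem_insert, Finset.mem_Icc]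
      omega
    rw [h, Finset.prod_insert (by simp)]
    ring

/-- Lemma 2.2 of the paper: the operator-norm distance between the exact derivative chain
`DF_i(x)` and the inexact chain `Df_i(w_{i+1}) ∘ ⋯ ∘ Df_T(w_{T+1})` (with `w_{T+1} = x`) is at
most `∑_{j=i}^{T-1} L∇f_j (∏_{l=i, l≠j}^T L_{f_l}) ‖F_{j+1}(x) − w_{j+1}‖`. -/
theorem stmt1
    (T : ℕ) (hT : 1 ≤ T)
    (E : ℕ → Type) [∀ i, NormedAddCommGroup (E i)] [∀ i, InnerProductSpace ℝ (E i)]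
    [∀ i, FiniteDimensional ℝ (E i)]
    (f : ∀ i, Lvl E i → Lvl E (i - 1))
    (Lf Ldf : ℕ → ℝ)
    (hLf : ∀ i, 1 ≤ i → i ≤ T → 0 ≤ Lf i)
    (hLdf : ∀ i, 1 ≤ i → i ≤ T → 0 ≤ Ldf i)
    (hfd : ∀ i, 1 ≤ i → i ≤ T → ContDiff ℝ 1 (f i))
    (hfLip : ∀ i, 1 ≤ i → i ≤ T → ∀ a b, ‖f i a - f i b‖ ≤ Lf i * ‖a - b‖)
    (hdfLip : ∀ i, 1 ≤ i → i ≤ T →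
      ∀ a b, ‖fderiv ℝ (f i) a - fderiv ℝ (f i) b‖ ≤ Ldf i * ‖a - b‖)
    (F : ∀ i, Lvl E T → Lvl E (i - 1))
    (hFtop : F (T + 1) = id)
    (hF : ∀ i, 1 ≤ i → i ≤ T → F i = f i ∘ F (i + 1))
    (i : ℕ) (hi1 : 1 ≤ i) (hiT : i ≤ T)
    (x : Lvl E T)
    -- the points `w j ∈ E_{j-1}`, with `w (T+1) = x`
    (w : ∀ j, Lvl E (j - 1)) (hw : w (T + 1) = x)
    -- the inexact derivative chain `P i = Df_i(w_{i+1}) ∘ Df_{i+1}(w_{i+2}) ∘ ⋯ ∘ Df_T(w_{T+1})`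
    (P : ∀ j, Lvl E T →L[ℝ] Lvl E (j - 1))
    (hPtop : P (T + 1) = ContinuousLinearMap.id ℝ (Lvl E T))
    (hP : ∀ j, 1 ≤ j → j ≤ T → P j = (fderiv ℝ (f j) (w (j + 1))).comp (P (j + 1))) :
    ‖fderiv ℝ (F i) x - P i‖ ≤
      ∑ j ∈ Ico i T, Ldf j * (∏ l ∈ (Icc i T).erase j, Lf l) * ‖F (j + 1) x - w (j + 1)‖ := by
  have key : ∀ j, j ≤ T + 1 → 1 ≤ j →
      DifferentiableAt ℝ (F j) x ∧ ‖fderiv ℝ (F j) x‖ ≤ ∏ l ∈ Icc j T, Lf l ∧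
      ‖fderiv ℝ (F j) x - P j‖ ≤
        ∑ k ∈ Ico j T, Ldf k * (∏ l ∈ (Icc j T).erase k, Lf l) * ‖F (k + 1) x - w (k + 1)‖ := by
    intro j hj
    induction hj using Nat.decreasingInduction with
    | self =>
      intro _
      have hfid : fderiv ℝ (F (T + 1)) x = ContinuousLinearMap.id ℝ (Lvl E T) := by
        rw [hFtop]
        exact fderiv_id
      refine ⟨by rw [hFtop]; exact differentiableAt_id, ?_, ?_⟩
      · rw [hfid]
        simpa using ContinuousLinearMap.norm_id_le
      · rw [hfid, hPtop]
        simp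
    | of_succ j hj ih =>
      intro hj1
      have hjT : j ≤ T := Nat.lt_succ_iff.mp hj
      obtain ⟨hd, hn, he⟩ := ih (by omega)
      have hfj : Differentiable ℝ (f j) := (hfd j hj1 hjT).differentiable one_ne_zero
      have hchain : fderiv ℝ (F j) x =
          (fderiv ℝ (f j) (F (j + 1) x)).comp (fderiv ℝ (F (j + 1)) x) := by
        rw [hF j hj1 hjT]
        exact fderiv_comp x (hfj _) hd
      have hbd := norm_fderiv_le_of_norm_sub_le (hLf j hj1 hjT) (hfLip j hj1 hjT)
      refine ⟨by rw [hF j hj1 hjT]; exact (hfj _).comp x hd, ?_, ?_⟩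
      · rw [hchain, ← Finset.mul_prod_Ioc_eq_prod_Icc hjT, ← Finset.Icc_add_one_left_eq_Ioc]
        refine (ContinuousLinearMap.opNorm_comp_le _ _).trans ?_
        exact mul_le_mul (hbd _) hn (norm_nonneg _) (hLf j hj1 hjT)
      · have hstep := norm_comp_sub_comp_le (hdfLip j hj1 hjT (F (j + 1) x) (w (j + 1))) he
          (hbd (w (j + 1))) hn
        rw [hchain, hP j hj1 hjT]
        refine hstep.trans_eq ?_
        rcases hjT.lt_or_eq with hlt | rfl
        · exact (sum_mul_prod_erase_eq hlt Lf Ldf fun k => ‖F (k + 1) x - w (k + 1)‖).symm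
        · have hzero : F (j + 1) x - w (j + 1) = 0 := by
            rw [hFtop, hw]
            exact sub_self x
          have hnorm : ‖F (j + 1) x - w (j + 1)‖ = 0 := by rw [hzero, norm_zero]
          erw [hnorm]
          simp
  exact (key i (by omega) hi1).2.2
end
end

section
/- Assume T ≥ 3. For any x ∈ E_T and any points w_j ∈ E_{j−1} for j = 2, …, T (set w_{T+1} := x), ‖DF(x) − Df_1(w_2) ∘ Df_2(w_3) ∘ ⋯ ∘ Df_{T−1}(w_T) ∘ Df_T(x)‖ ≤ Σ_{j=2}^{T−1} C_j ‖f_j(w_{j+1}) − w_j‖ + C_T ‖f_T(x) − w_T‖, where the left-hand norm is the operator norm of a linear map E_T → ℝ. -/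
open scoped RealInnerProductSpace
open Finset

noncomputable section

/-- Backward discrete Grönwall inequality: unrolling `a i ≤ L i * a (i + 1) + b i` from `m` up to
a terminal index `n` at which `a` is nonpositive. -/
theorem le_sum_prod_mul_of_le_mul_succ_add {L a b : ℕ → ℝ} {m n : ℕ} (hmn : m ≤ n)
    (hL : ∀ i, m ≤ i → i < n → 0 ≤ L i)
    (hab : ∀ i, m ≤ i → i < n → a i ≤ L i * a (i + 1) + b i) (ha : a n ≤ 0) :
    a m ≤ ∑ j ∈ Ico m n, (∏ l ∈ Ico m j, L l) * b j := by
  induction hmn using Nat.decreasingInduction with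
  | self => simpa using ha
  | of_succ k hk ih =>
    have hstep := ih (fun i hi => hL i (by lia)) (fun i hi => hab i (by lia))
    calc a k ≤ L k * a (k + 1) + b k := hab k le_rfl hk
      _ ≤ L k * ∑ j ∈ Ico (k + 1) n, (∏ l ∈ Ico (k + 1) j, L l) * b j + b k := by
        gcongr
        exact hL k le_rfl hk
      _ = ∑ j ∈ Ico k n, (∏ l ∈ Ico k j, L l) * b j := by
        rw [sum_eq_sum_Ico_succ_bot hk, mul_sum, add_comm]
        congr 1
        · simp
        · refine sum_congr rfl fun j hj => ?_
          rw [prod_eq_prod_Ico_succ_bot (show k < j by grind), mul_assoc]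

/-- Removing one index from a product over an interval leaves the products below and above it. -/
theorem prod_Icc_erase_eq_mul (L : ℕ → ℝ) {i T : ℕ} (hi : 1 ≤ i) (hiT : i ≤ T) :
    ∏ l ∈ (Icc 1 T).erase i, L l = (∏ l ∈ Ico 1 i, L l) * ∏ l ∈ Ico (i + 1) (T + 1), L l := by
  rw [← prod_union]
  · congr 1
    grind
  · rw [disjoint_left]
    grind

theorem sum_mul_sum_prod_mul_comm (T : ℕ) (R L δ : ℕ → ℝ) :
    ∑ i ∈ Ico 1 T, R i * ∑ j ∈ Ico (i + 1) (T + 1), (∏ l ∈ Ico (i + 1) j, L l) * δ j =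
      ∑ j ∈ Ico 2 (T + 1), (∑ i ∈ Ico 1 j, R i * ∏ l ∈ Ico (i + 1) j, L l) * δ j := by
  simp_rw [mul_sum]
  rw [sum_comm' (t' := Ico 2 (T + 1)) (s' := fun j => Ico 1 j) (by grind)]
  refine sum_congr rfl fun j hj => ?_
  rw [sum_mul]
  exact sum_congr rfl fun i _ => by ring

section NormedSpace

variable {G H K : Type*} [NormedAddCommGroup G] [NormedSpace ℝ G] [NormedAddCommGroup H]
  [NormedSpace ℝ H] [NormedAddCommGroup K] [NormedSpace ℝ K]

theorem norm_fderiv_le_of_norm_sub_le_s3 {f : H → K} {L : ℝ} (hL : 0 ≤ L)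
    (hf : ∀ a b, ‖f a - f b‖ ≤ L * ‖a - b‖) (y : H) : ‖fderiv ℝ f y‖ ≤ L :=
  norm_fderiv_le_of_lip' ℝ hL (.of_forall fun z => hf z y)

/-- Replacing both factors of a composition of linear maps costs the sum of the two errors. -/
theorem ContinuousLinearMap.norm_comp_sub_comp_le (A B : H →L[ℝ] K) (D P : G →L[ℝ] H) :
    ‖A.comp D - B.comp P‖ ≤ ‖B‖ * ‖D - P‖ + ‖A - B‖ * ‖D‖ := by
  have h : A.comp D - B.comp P = B.comp (D - P) + (A - B).comp D := by
    ext v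
    simp
  rw [h]
  exact (norm_add_le _ _).trans
    (add_le_add (opNorm_comp_le _ _) (opNorm_comp_le _ _))

end NormedSpace

/-- Lemma 2.4 of the paper: for `T ≥ 3`, with `R_j = L∇f_j ∏_{l=1,l≠j}^T L_{f_l}` and
`C_j = ∑_{i=1}^{j-1} R_i ∏_{l=i+1}^{j-1} L_{f_l}`,
`‖DF(x) − Df_1(w_2) ∘ ⋯ ∘ Df_T(x)‖ ≤ ∑_{j=2}^{T-1} C_j ‖f_j(w_{j+1}) − w_j‖ + C_T ‖f_T(x) − w_T‖`,
where the left-hand norm is the operator norm of a linear map `E_T → ℝ`. -/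
theorem stmt3
    (T : ℕ) (hT : 3 ≤ T)
    (E : ℕ → Type) [∀ i, NormedAddCommGroup (E i)] [∀ i, InnerProductSpace ℝ (E i)]
    [∀ i, FiniteDimensional ℝ (E i)]
    (f : ∀ i, Lvl E i → Lvl E (i - 1))
    (Lf Ldf : ℕ → ℝ)
    (hLf : ∀ i, 1 ≤ i → i ≤ T → 0 ≤ Lf i)
    (hLdf : ∀ i, 1 ≤ i → i ≤ T → 0 ≤ Ldf i)
    (hfd : ∀ i, 1 ≤ i → i ≤ T → ContDiff ℝ 1 (f i))
    (hfLip : ∀ i, 1 ≤ i → i ≤ T → ∀ a b, ‖f i a - f i b‖ ≤ Lf i * ‖a - b‖)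
    (hdfLip : ∀ i, 1 ≤ i → i ≤ T →
      ∀ a b, ‖fderiv ℝ (f i) a - fderiv ℝ (f i) b‖ ≤ Ldf i * ‖a - b‖)
    (F : ∀ i, Lvl E T → Lvl E (i - 1))
    (hFtop : F (T + 1) = id)
    (hF : ∀ i, 1 ≤ i → i ≤ T → F i = f i ∘ F (i + 1))
    -- the constants `R_j` and `C_j`
    (Rc C : ℕ → ℝ)
    (hRc : ∀ j, 1 ≤ j → j + 1 ≤ T → Rc j = Ldf j * ∏ l ∈ (Icc 1 T).erase j, Lf l)
    (hC : ∀ j, 2 ≤ j → j ≤ T → C j = ∑ i ∈ Ico 1 j, Rc i * ∏ l ∈ Ico (i + 1) j, Lf l)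
    (x : Lvl E T)
    -- the points `w j ∈ E_{j-1}` for `j = 2, …, T`, with `w (T+1) = x`
    (w : ∀ j, Lvl E (j - 1)) (hw : w (T + 1) = x)
    -- the inexact derivative chain `P i = Df_i(w_{i+1}) ∘ ⋯ ∘ Df_T(w_{T+1})`
    (P : ∀ j, Lvl E T →L[ℝ] Lvl E (j - 1))
    (hPtop : P (T + 1) = ContinuousLinearMap.id ℝ (Lvl E T))
    (hP : ∀ j, 1 ≤ j → j ≤ T → P j = (fderiv ℝ (f j) (w (j + 1))).comp (P (j + 1))) :
    ‖fderiv ℝ (F 1) x - P 1‖ ≤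
      (∑ j ∈ Ico 2 T, C j * ‖f j (w (j + 1)) - w j‖) + C T * ‖f T x - w T‖ := by
  have hdiff : ∀ n ≤ T + 1, 1 ≤ n → DifferentiableAt ℝ (F n) x ∧
      ‖fderiv ℝ (F n) x‖ ≤ ∏ l ∈ Ico n (T + 1), Lf l := by
    intro n hn
    induction hn using Nat.decreasingInduction with
    | self =>
      intro _
      rw [hFtop]
      refine ⟨differentiableAt_id, ?_⟩
      rw [fderiv_id]
      simpa using ContinuousLinearMap.norm_id_le
    | of_succ k hk ih =>
      intro hk1
      obtain ⟨hd, hn⟩ := ih (by lia)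
      have hfk : DifferentiableAt ℝ (f k) (F (k + 1) x) :=
        ((hfd k hk1 (by lia)).differentiable one_ne_zero) _
      rw [hF k hk1 (by lia)]
      refine ⟨hfk.comp x hd, ?_⟩
      rw [fderiv_comp x hfk hd, prod_eq_prod_Ico_succ_bot hk]
      refine (ContinuousLinearMap.opNorm_comp_le _ _).trans ?_
      have := hLf k hk1 (by lia)
      exact mul_le_mul (norm_fderiv_le_of_norm_sub_le_s3 this (hfLip k hk1 (by lia)) _) hn
        (norm_nonneg _) this
  have hfderiv : ∀ k, 1 ≤ k → k ≤ T → fderiv ℝ (F k) x =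
      (fderiv ℝ (f k) (F (k + 1) x)).comp (fderiv ℝ (F (k + 1)) x) := by
    intro k hk hkT
    rw [hF k hk hkT]
    exact fderiv_comp x (((hfd k hk hkT).differentiable one_ne_zero) _)
      (hdiff (k + 1) (by lia) (by lia)).1
  have hdtop : ‖F (T + 1) x - w (T + 1)‖ = 0 := by
    rw [hFtop, hw]
    exact norm_eq_zero.2 (sub_self x)
  have hetop : ‖fderiv ℝ (F (T + 1)) x - P (T + 1)‖ = 0 := by
    rw [hFtop, hPtop]
    refine norm_eq_zero.2 (sub_eq_zero.2 ?_)
    exact fderiv_id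
  have hd : ∀ i, 1 ≤ i → i ≤ T → ‖F (i + 1) x - w (i + 1)‖ ≤
      ∑ j ∈ Ico (i + 1) (T + 1), (∏ l ∈ Ico (i + 1) j, Lf l) * ‖f j (w (j + 1)) - w j‖ := by
    intro i hi hiT
    refine le_sum_prod_mul_of_le_mul_succ_add (a := fun n => ‖F n x - w n‖) (by lia)
      (fun k hk hk' => hLf k (by lia) (by lia)) (fun k hk hk' => ?_) hdtop.le
    have hFk : F k x = f k (F (k + 1) x) := congrFun (hF k (by lia) (by lia)) x
    rw [hFk]
    refine (norm_sub_le_norm_sub_add_norm_sub _ (f k (w (k + 1))) _).trans ?_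
    gcongr
    exact hfLip k (by lia) (by lia) _ _
  have he := le_sum_prod_mul_of_le_mul_succ_add (L := Lf) (m := 1) (n := T + 1)
    (a := fun n => ‖fderiv ℝ (F n) x - P n‖)
    (b := fun i => Ldf i * ‖F (i + 1) x - w (i + 1)‖ * ∏ l ∈ Ico (i + 1) (T + 1), Lf l)
    (by lia) (fun k hk hk' => hLf k (by lia) (by lia)) (fun k hk hk' => by
      have hLk := hLf k hk (by lia)
      rw [hfderiv k hk (by lia), hP k hk (by lia)]
      refine (ContinuousLinearMap.norm_comp_sub_comp_le _ _ _ _).trans (add_le_add ?_ ?_)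
      · exact mul_le_mul_of_nonneg_right
          (norm_fderiv_le_of_norm_sub_le_s3 hLk (hfLip k hk (by lia)) _) (norm_nonneg _)
      · exact mul_le_mul (hdfLip k hk (by lia) _ _) (hdiff (k + 1) (by lia) (by lia)).2
          (norm_nonneg _) (mul_nonneg (hLdf k hk (by lia)) (norm_nonneg _))) hetop.le
  set δ : ℕ → ℝ := fun j => ‖f j (w (j + 1)) - w j‖ with hδ
  calc ‖fderiv ℝ (F 1) x - P 1‖
      ≤ ∑ i ∈ Ico 1 T, Rc i * ‖F (i + 1) x - w (i + 1)‖ := by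
        refine he.trans_eq ?_
        rw [sum_Ico_succ_top (by lia), hdtop]
        simp only [mul_zero, zero_mul, add_zero]
        refine sum_congr rfl fun i hi => ?_
        obtain ⟨hi1, hiT⟩ := mem_Ico.1 hi
        rw [hRc i hi1 hiT, prod_Icc_erase_eq_mul Lf hi1 hiT.le]
        ring
    _ ≤ ∑ i ∈ Ico 1 T, Rc i * ∑ j ∈ Ico (i + 1) (T + 1), (∏ l ∈ Ico (i + 1) j, Lf l) * δ j := by
        refine sum_le_sum fun i hi => ?_
        obtain ⟨hi1, hiT⟩ := mem_Ico.1 hi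
        refine mul_le_mul_of_nonneg_left (hd i hi1 hiT.le) ?_
        rw [hRc i hi1 hiT]
        exact mul_nonneg (hLdf i hi1 hiT.le) (prod_nonneg fun l hl =>
          hLf l (mem_Icc.1 (mem_of_mem_erase hl)).1 (mem_Icc.1 (mem_of_mem_erase hl)).2)
    _ = ∑ j ∈ Ico 2 (T + 1), C j * δ j := by
        rw [sum_mul_sum_prod_mul_comm]
        refine sum_congr rfl fun j hj => ?_
        obtain ⟨hj2, hjT⟩ := mem_Ico.1 hj
        rw [hC j hj2 (Nat.lt_succ_iff.1 hjT)]
    _ = (∑ j ∈ Ico 2 T, C j * δ j) + C T * ‖f T x - w T‖ := by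
        rw [sum_Ico_succ_top (by lia), hδ, ← hw]
end
end

section
/- Let H be a real inner product space, let τ ∈ (0, 1], and let a, b, w, e ∈ H. Define w' = (1 − τ)w + τ(b − e), A = a − b, and r = 2τ⟨e, A + (1 − τ)(b − w)⟩. Then ‖a − w'‖² ≤ (1 − τ)‖b − w‖² + (1/τ)‖A‖² + τ²‖e‖² + r. -/
open scoped RealInnerProductSpace

noncomputable section

/-- Convexity bound for `x + (1 - τ) y`, written as the combination `τ (x / τ) + (1 - τ) y`. -/
theorem norm_add_one_sub_smul_sq_le {E : Type*} [NormedAddCommGroup E] [InnerProductSpace ℝ E]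
    {τ : ℝ} (hτ0 : 0 < τ) (hτ1 : τ ≤ 1) (x y : E) :
    ‖x + (1 - τ) • y‖ ^ 2 ≤ (1 - τ) * ‖y‖ ^ 2 + (1 / τ) * ‖x‖ ^ 2 := by
  have hgap : (1 - τ) * ‖y‖ ^ 2 + (1 / τ) * ‖x‖ ^ 2 - ‖x + (1 - τ) • y‖ ^ 2
      = (1 - τ) / τ * ‖x - τ • y‖ ^ 2 := by
    rw [norm_add_sq_real, norm_sub_sq_real, norm_smul, norm_smul, mul_pow, mul_pow,
      Real.norm_eq_abs, Real.norm_eq_abs, sq_abs, sq_abs, real_inner_smul_right,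
      real_inner_smul_right]
    field_simp
    ring
  have hnonneg : 0 ≤ (1 - τ) / τ * ‖x - τ • y‖ ^ 2 :=
    mul_nonneg (div_nonneg (sub_nonneg.2 hτ1) hτ0.le) (sq_nonneg _)
  linarith

/-- One-iteration estimate behind Lemma 2.6(a) of the paper: with
`w' = (1 − τ)w + τ(b − e)`, `A = a − b`, and `r = 2τ⟨e, A + (1 − τ)(b − w)⟩`, one has
`‖a − w'‖² ≤ (1 − τ)‖b − w‖² + (1/τ)‖A‖² + τ²‖e‖² + r`. -/
theorem stmt7
    (H : Type) [NormedAddCommGroup H] [InnerProductSpace ℝ H]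
    (τ : ℝ) (hτ0 : 0 < τ) (hτ1 : τ ≤ 1)
    (a b w e : H)
    (w' : H) (hw' : w' = (1 - τ) • w + τ • (b - e))
    (A : H) (hA : A = a - b)
    (r : ℝ) (hr : r = 2 * τ * ⟪e, A + (1 - τ) • (b - w)⟫) :
    ‖a - w'‖ ^ 2 ≤ (1 - τ) * ‖b - w‖ ^ 2 + (1 / τ) * ‖A‖ ^ 2 + τ ^ 2 * ‖e‖ ^ 2 + r := by
  have hsplit : a - w' = (A + (1 - τ) • (b - w)) + τ • e := by
    rw [hw', hA]
    module
  rw [hsplit, norm_add_sq_real, norm_smul, mul_pow, Real.norm_eq_abs, sq_abs,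
    real_inner_smul_right, real_inner_comm, hr]
  linarith [norm_add_one_sub_smul_sq_le hτ0 hτ1 A (b - w)]
end
end

section
/- Let E and H be real inner product spaces and let f : E → H be Lipschitz with constant L ≥ 0. Let τ ∈ (0, 1], x, u ∈ E, and w, e ∈ H. Define x' = (1 − τ)x + τu, d = u − x, w' = (1 − τ)w + τ(f(x) − e), and r = 2τ⟨e, (f(x') − f(x)) + (1 − τ)(f(x) − w)⟩. Then ‖f(x') − w'‖² ≤ (1 − τ)‖f(x) − w‖² + L²τ‖d‖² + τ²‖e‖² + r. -/
open scoped RealInnerProductSpace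

noncomputable section

/-- One-iteration estimate of Lemma 2.6(b) of the paper for the innermost level: with
`x' = (1 − τ)x + τu`, `d = u − x`, `w' = (1 − τ)w + τ(f(x) − e)`, and
`r = 2τ⟨e, (f(x') − f(x)) + (1 − τ)(f(x) − w)⟩`, one has
`‖f(x') − w'‖² ≤ (1 − τ)‖f(x) − w‖² + L²τ‖d‖² + τ²‖e‖² + r`. -/
theorem stmt8
    (E H : Type) [NormedAddCommGroup E] [InnerProductSpace ℝ E]
    [NormedAddCommGroup H] [InnerProductSpace ℝ H]
    (f : E → H) (L : ℝ) (hL : 0 ≤ L)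
    (hf : ∀ a b, ‖f a - f b‖ ≤ L * ‖a - b‖)
    (τ : ℝ) (hτ0 : 0 < τ) (hτ1 : τ ≤ 1)
    (x u : E) (w e : H)
    (x' : E) (hx' : x' = (1 - τ) • x + τ • u)
    (d : E) (hd : d = u - x)
    (w' : H) (hw' : w' = (1 - τ) • w + τ • (f x - e))
    (r : ℝ) (hr : r = 2 * τ * ⟪e, (f x' - f x) + (1 - τ) • (f x - w)⟫) :
    ‖f x' - w'‖ ^ 2 ≤
      (1 - τ) * ‖f x - w‖ ^ 2 + L ^ 2 * τ * ‖d‖ ^ 2 + τ ^ 2 * ‖e‖ ^ 2 + r := by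
  have hx : x' - x = τ • d := by rw [hx', hd]; module
  have hlip : ‖f x' - f x‖ ≤ τ * (L * ‖d‖) := by
    have h := hf x' x
    rw [hx, norm_smul, Real.norm_of_nonneg hτ0.le] at h
    linarith
  have hw : f x' - w' = ((f x' - f x) + (1 - τ) • (f x - w)) + τ • e := by
    rw [hw']; module
  have hnorm : ‖(f x' - f x) + (1 - τ) • (f x - w)‖ ≤
      (1 - τ) * ‖f x - w‖ + τ * (L * ‖d‖) := by
    have h := norm_add_le (f x' - f x) ((1 - τ) • (f x - w))
    rw [norm_smul, Real.norm_of_nonneg (sub_nonneg.mpr hτ1)] at h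
    linarith
  have hsq := pow_le_pow_left₀ (norm_nonneg _) hnorm 2
  -- convexity of the square
  have hconv : ((1 - τ) * ‖f x - w‖ + τ * (L * ‖d‖)) ^ 2 ≤
      (1 - τ) * ‖f x - w‖ ^ 2 + τ * (L * ‖d‖) ^ 2 := by
    nlinarith [mul_nonneg (mul_nonneg hτ0.le (sub_nonneg.mpr hτ1))
      (sq_nonneg (‖f x - w‖ - L * ‖d‖))]
  rw [hw, norm_add_sq_real, norm_smul, Real.norm_of_nonneg hτ0.le, real_inner_smul_right,
    real_inner_comm, hr]
  linarith
end
end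

section
/- Let E and H be real inner product spaces and let f : E → H be Lipschitz with constant L ≥ 0. Let τ ∈ (0, 1], v, b, e₊ ∈ E, and w, e ∈ H. Define v' = (1 − τ)v + τ(b − e₊), w' = (1 − τ)w + τ(f(v) − e), r = 2τ⟨e, (f(v') − f(v)) + (1 − τ)(f(v) − w)⟩, and r̄ = −2τL²⟨e₊, b − v⟩ + r. Then ‖f(v') − w'‖² ≤ (1 − τ)‖f(v) − w‖² + L²τ(‖b − v‖² + ‖e₊‖²) + τ²‖e‖² + r̄. -/
open scoped RealInnerProductSpace

noncomputable section

/-- Convexity of the squared norm, in the form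
`‖d + (1 - τ) a‖² ≤ (1 - τ) ‖a‖² + τ⁻¹ ‖d‖²` cleared of denominators. -/
theorem mul_norm_add_smul_sq_le {H : Type*} [NormedAddCommGroup H] [InnerProductSpace ℝ H]
    {τ : ℝ} (hτ1 : τ ≤ 1) (d a : H) :
    τ * ‖d + (1 - τ) • a‖ ^ 2 ≤ τ * ((1 - τ) * ‖a‖ ^ 2) + ‖d‖ ^ 2 := by
  have h := mul_nonneg (sub_nonneg.mpr hτ1) (sq_nonneg ‖d - τ • a‖)
  rw [norm_sub_sq_real, norm_smul, inner_smul_right, mul_pow, Real.norm_eq_abs, sq_abs] at h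
  rw [norm_add_sq_real, norm_smul, inner_smul_right, mul_pow, Real.norm_eq_abs, sq_abs]
  linarith

/-- One-iteration estimate of Lemma 2.6(b) of the paper for an intermediate level: with
`v' = (1 − τ)v + τ(b − e₊)`, `w' = (1 − τ)w + τ(f(v) − e)`,
`r = 2τ⟨e, (f(v') − f(v)) + (1 − τ)(f(v) − w)⟩`, and `r̄ = −2τL²⟨e₊, b − v⟩ + r`, one has
`‖f(v') − w'‖² ≤ (1 − τ)‖f(v) − w‖² + L²τ(‖b − v‖² + ‖e₊‖²) + τ²‖e‖² + r̄`. -/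
theorem stmt9
    (E H : Type) [NormedAddCommGroup E] [InnerProductSpace ℝ E]
    [NormedAddCommGroup H] [InnerProductSpace ℝ H]
    (f : E → H) (L : ℝ) (hL : 0 ≤ L)
    (hf : ∀ a b, ‖f a - f b‖ ≤ L * ‖a - b‖)
    (τ : ℝ) (hτ0 : 0 < τ) (hτ1 : τ ≤ 1)
    (v b eplus : E) (w e : H)
    (v' : E) (hv' : v' = (1 - τ) • v + τ • (b - eplus))
    (w' : H) (hw' : w' = (1 - τ) • w + τ • (f v - e))
    (r : ℝ) (hr : r = 2 * τ * ⟪e, (f v' - f v) + (1 - τ) • (f v - w)⟫)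
    (rbar : ℝ) (hrbar : rbar = -(2 * τ * L ^ 2) * ⟪eplus, b - v⟫ + r) :
    ‖f v' - w'‖ ^ 2 ≤
      (1 - τ) * ‖f v - w‖ ^ 2 + L ^ 2 * τ * (‖b - v‖ ^ 2 + ‖eplus‖ ^ 2)
        + τ ^ 2 * ‖e‖ ^ 2 + rbar := by
  have step : v' - v = τ • (b - v - eplus) := by rw [hv']; module
  have split : f v' - w' = (f v' - f v + (1 - τ) • (f v - w)) + τ • e := by rw [hw']; module
  have lip : ‖f v' - f v‖ ^ 2 ≤
      τ * (L ^ 2 * τ * (‖b - v‖ ^ 2 - 2 * ⟪eplus, b - v⟫ + ‖eplus‖ ^ 2)) := by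
    calc ‖f v' - f v‖ ^ 2 ≤ (L * ‖v' - v‖) ^ 2 := by gcongr; exact hf v' v
      _ = _ := by
        rw [step, norm_smul, mul_pow, mul_pow, norm_sub_sq_real, Real.norm_eq_abs, sq_abs,
          real_inner_comm]
        ring
  have key : ‖f v' - f v + (1 - τ) • (f v - w)‖ ^ 2 ≤ (1 - τ) * ‖f v - w‖ ^ 2 +
      L ^ 2 * τ * (‖b - v‖ ^ 2 - 2 * ⟪eplus, b - v⟫ + ‖eplus‖ ^ 2) := by
    refine le_of_mul_le_mul_left ?_ hτ0
    linarith [mul_norm_add_smul_sq_le hτ1 (f v' - f v) (f v - w)]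
  rw [split, norm_add_sq_real, norm_smul, inner_smul_right, mul_pow, Real.norm_eq_abs, sq_abs,
    real_inner_comm, hrbar, hr]
  linarith
end
end

section
/- Let N ≥ 1, let τ_0 = 1 and τ_k ∈ (0, 1) for 1 ≤ k ≤ N, and let c > 0 satisfy Σ_{i=k+1}^{N} τ_i Γ_i ≤ c·Γ_{k+1} for every 0 ≤ k ≤ N−1. If real sequences {q_k} and {p_k} satisfy p_k ≥ 0 and q_{k+1} ≤ (1 − τ_k)q_k + τ_k p_k for all 0 ≤ k ≤ N−1, then Σ_{k=1}^{N} τ_k q_k ≤ c · Σ_{k=0}^{N−1} τ_k p_k. -/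
open Finset

noncomputable section

/-- Discrete Gronwall-type bound: unrolling `q (k + 1) ≤ (1 - τ k) * q k + τ k * p k` from
`τ 0 = 1` against an integrating factor `Γ`. -/
theorem le_integratingFactor_mul_sum {N : ℕ} {τ Γ q p : ℕ → ℝ} (hτ0 : τ 0 = 1)
    (hτ : ∀ k, 1 ≤ k → k ≤ N → τ k ≤ 1)
    (hpos : ∀ k, 1 ≤ k → k ≤ N → 0 < Γ k)
    (hrec : ∀ k, 1 ≤ k → Γ (k + 1) = (1 - τ k) * Γ k)
    (hq : ∀ k < N, q (k + 1) ≤ (1 - τ k) * q k + τ k * p k)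
    {k : ℕ} (hk : 1 ≤ k) (hkN : k ≤ N) :
    q k ≤ Γ k * ∑ i ∈ range k, τ i * p i / Γ (i + 1) := by
  induction k, hk using Nat.le_induction with
  | base =>
    have hne := (hpos 1 le_rfl hkN).ne'
    have h := hq 0 hkN
    simp only [hτ0, zero_add] at h
    simp only [range_one, sum_singleton, hτ0, zero_add]
    rw [mul_div_cancel₀ _ hne]
    linarith
  | succ k hk ih =>
    have hne := (hpos (k + 1) (by omega) hkN).ne'
    have h := mul_le_mul_of_nonneg_left (ih (by omega))
      (sub_nonneg.2 (hτ k hk (by omega)))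
    rw [sum_range_succ, mul_add, mul_div_cancel₀ _ hne, hrec k hk, mul_assoc]
    linarith [hq k hkN]

/-- The summation estimate used in the proof of Theorem 2.10(a) of the paper: if `τ_0 = 1`,
`τ_k ∈ (0,1)` for `1 ≤ k ≤ N`, `∑_{i=k+1}^N τ_i Γ_i ≤ c Γ_{k+1}` for `0 ≤ k ≤ N−1`,
`p_k ≥ 0`, and `q_{k+1} ≤ (1 − τ_k)q_k + τ_k p_k` for `0 ≤ k ≤ N−1`, then
`∑_{k=1}^N τ_k q_k ≤ c ∑_{k=0}^{N−1} τ_k p_k`. -/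
theorem stmt13
    (N : ℕ) (hN : 1 ≤ N)
    (τ : ℕ → ℝ) (hτ0 : τ 0 = 1) (hτ : ∀ k, 1 ≤ k → k ≤ N → 0 < τ k ∧ τ k < 1)
    (Γ : ℕ → ℝ)
    (hΓ : ∀ k, 1 ≤ k →
      Γ k = (if τ 0 = 1 then 1 else 1 - τ 0) * ∏ i ∈ Ico 1 k, (1 - τ i))
    (c : ℝ) (hc : 0 < c)
    (hsum : ∀ k < N, (∑ i ∈ Icc (k + 1) N, τ i * Γ i) ≤ c * Γ (k + 1))
    (q p : ℕ → ℝ)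
    (hp : ∀ k < N, 0 ≤ p k)
    (hq : ∀ k < N, q (k + 1) ≤ (1 - τ k) * q k + τ k * p k) :
    (∑ k ∈ Icc 1 N, τ k * q k) ≤ c * ∑ k ∈ range N, τ k * p k := by
  have hrec : ∀ k, 1 ≤ k → Γ (k + 1) = (1 - τ k) * Γ k := fun k hk => by
    rw [hΓ k hk, hΓ (k + 1) (by omega), prod_Ico_succ_top hk]
    ring
  have hpos : ∀ k, 1 ≤ k → k ≤ N → 0 < Γ k := fun k hk hkN => by
    rw [hΓ k hk, if_pos hτ0, one_mul]
    refine prod_pos fun i hi => ?_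
    rw [mem_Ico] at hi
    linarith [(hτ i hi.1 (by omega)).2]
  have hτ_nonneg : ∀ k, k ≤ N → 0 ≤ τ k := fun k hkN => by
    rcases Nat.eq_zero_or_pos k with rfl | hk
    · simp [hτ0]
    · exact (hτ k hk hkN).1.le
  calc ∑ k ∈ Icc 1 N, τ k * q k
      ≤ ∑ k ∈ Icc 1 N, ∑ i ∈ range k, τ k * Γ k * (τ i * p i / Γ (i + 1)) := by
        refine sum_le_sum fun k hk => ?_
        rw [mem_Icc] at hk
        rw [← mul_sum, mul_assoc]
        exact mul_le_mul_of_nonneg_left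
          (le_integratingFactor_mul_sum hτ0 (fun j hj hjN => (hτ j hj hjN).2.le) hpos hrec hq
            hk.1 hk.2) (hτ_nonneg k hk.2)
    _ = ∑ i ∈ range N, ∑ k ∈ Icc (i + 1) N, τ k * Γ k * (τ i * p i / Γ (i + 1)) := by
        refine sum_comm' fun k i => ?_
        simp only [mem_Icc, mem_range]
        omega
    _ ≤ ∑ i ∈ range N, c * (τ i * p i) := by
        refine sum_le_sum fun i hi => ?_
        rw [mem_range] at hi
        have hΓi := hpos (i + 1) (by omega) hi
        rw [← sum_mul]
        calc (∑ k ∈ Icc (i + 1) N, τ k * Γ k) * (τ i * p i / Γ (i + 1))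
            ≤ c * Γ (i + 1) * (τ i * p i / Γ (i + 1)) :=
              mul_le_mul_of_nonneg_right (hsum i hi)
                (div_nonneg (mul_nonneg (hτ_nonneg i hi.le) (hp i hi)) hΓi.le)
          _ = c * (τ i * p i) := by rw [mul_assoc, mul_div_cancel₀ _ hΓi.ne']
    _ = c * ∑ k ∈ range N, τ k * p k := (mul_sum _ _ _).symm
end
end

section
/- Let E and H be real inner product spaces and let f : E → H be a differentiable map that is Lipschitz with constant L_f ≥ 0 and whose Fréchet derivative Df is Lipschitz with constant L_{∇f} ≥ 0. Let τ ∈ (0, 1], v, v' ∈ E, w, G ∈ H, and let J : E → H be a continuous linear map. Define e = f(v) − G, ê = Df(v) − J (a linear map E → H with operator norm ‖ê‖), Â = f(v') − f(v) − Df(v)(v' − v), w' = (1 − τ)w + τG + J(v' − v), and ṙ = 2τ⟨e, Â + (1 − τ)(f(v) − w) + ê(v' − v)⟩ + 2⟨ê(v' − v), Â + (1 − τ)(f(v) − w)⟩. Then ‖f(v') − w'‖² ≤ (1 − τ)‖f(v) − w‖² + τ²‖e‖² + ṙ + [8L_f² + L_{∇f}‖f(v) − w‖ + ‖ê‖²]·‖v'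 − v‖². -/
open scoped RealInnerProductSpace

noncomputable section

/-- Second-order Taylor remainder bound for a map whose derivative is Lipschitz. -/
theorem norm_sub_sub_fderiv_le_of_fderiv_lipschitz
    {E F : Type*} [NormedAddCommGroup E] [NormedSpace ℝ E]
    [NormedAddCommGroup F] [NormedSpace ℝ F] {f : E → F} {L : ℝ}
    (hf : Differentiable ℝ f)
    (hL : ∀ a b, ‖fderiv ℝ f a - fderiv ℝ f b‖ ≤ L * ‖a - b‖) (x y : E) :
    ‖f y - f x - fderiv ℝ f x (y - x)‖ ≤ L / 2 * ‖y - x‖ ^ 2 := by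
  set d := y - x with hd
  have hg : ∀ t : ℝ, HasDerivAt (fun t : ℝ => f (x + t • d) - f x - t • fderiv ℝ f x d)
      (fderiv ℝ f (x + t • d) d - fderiv ℝ f x d) t := by
    intro t
    have hline : HasDerivAt (fun t : ℝ => x + t • d) d t := by
      simpa using ((hasDerivAt_id t).smul_const d).const_add x
    have hlin : HasDerivAt (fun t : ℝ => t • fderiv ℝ f x d) (fderiv ℝ f x d) t := by
      simpa using (hasDerivAt_id t).smul_const (fderiv ℝ f x d)
    exact (((hf _).hasFDerivAt.comp_hasDerivAt t hline).sub_const (f x)).sub hlin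
  have hB : ∀ t : ℝ, HasDerivAt (fun t : ℝ => L / 2 * ‖d‖ ^ 2 * t ^ 2) (L * ‖d‖ ^ 2 * t) t := by
    intro t
    refine ((hasDerivAt_pow 2 t).const_mul (L / 2 * ‖d‖ ^ 2)).congr_deriv ?_
    push_cast
    ring
  have key := image_norm_le_of_norm_deriv_right_le_deriv_boundary (a := 0) (b := 1)
    (fun t _ => (hg t).continuousAt.continuousWithinAt)
    (fun t _ => (hg t).hasDerivWithinAt) (by simp) hB
    (fun t ht => by
      calc ‖fderiv ℝ f (x + t • d) d - fderiv ℝ f x d‖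
          ≤ ‖fderiv ℝ f (x + t • d) - fderiv ℝ f x‖ * ‖d‖ :=
            (fderiv ℝ f (x + t • d) - fderiv ℝ f x).le_opNorm d
        _ ≤ L * ‖x + t • d - x‖ * ‖d‖ := by gcongr; exact hL _ _
        _ = L * ‖d‖ ^ 2 * t := by
            rw [add_sub_cancel_left, norm_smul, Real.norm_of_nonneg ht.1]
            ring)
    (Set.right_mem_Icc.2 zero_le_one)
  simpa [hd] using key

/-- First-order remainder bound for a Lipschitz map. -/
theorem norm_sub_sub_fderiv_le_of_lipschitz
    {E F : Type*} [NormedAddCommGroup E] [NormedSpace ℝ E]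
    [NormedAddCommGroup F] [NormedSpace ℝ F] {f : E → F} {L : ℝ} (hL0 : 0 ≤ L)
    (hL : ∀ a b, ‖f a - f b‖ ≤ L * ‖a - b‖) (x y : E) :
    ‖f y - f x - fderiv ℝ f x (y - x)‖ ≤ 2 * L * ‖y - x‖ := by
  have hD : ‖fderiv ℝ f x‖ ≤ L :=
    norm_fderiv_le_of_lip' ℝ hL0 (Filter.Eventually.of_forall fun a => hL a x)
  calc ‖f y - f x - fderiv ℝ f x (y - x)‖
      ≤ ‖f y - f x‖ + ‖fderiv ℝ f x (y - x)‖ := norm_sub_le _ _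
    _ ≤ L * ‖y - x‖ + L * ‖y - x‖ :=
        add_le_add (hL y x) ((fderiv ℝ f x).le_of_opNorm_le hD _)
    _ = 2 * L * ‖y - x‖ := by ring

/-- One-iteration estimate of Lemma 3.1(a) of the paper for the linearized moving-average
update: with `e = f(v) − G`, `ê = Df(v) − J`, `Â = f(v') − f(v) − Df(v)(v' − v)`,
`w' = (1 − τ)w + τG + J(v' − v)`, and
`ṙ = 2τ⟨e, Â + (1 − τ)(f(v) − w) + ê(v' − v)⟩ + 2⟨ê(v' − v), Â + (1 − τ)(f(v) − w)⟩`, one has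
`‖f(v') − w'‖² ≤ (1 − τ)‖f(v) − w‖² + τ²‖e‖² + ṙ
  + [8L_f² + L_{∇f}‖f(v) − w‖ + ‖ê‖²]‖v' − v‖²`. -/
theorem stmt16
    (E H : Type) [NormedAddCommGroup E] [InnerProductSpace ℝ E]
    [NormedAddCommGroup H] [InnerProductSpace ℝ H]
    (f : E → H) (Lf Ldf : ℝ) (hLf : 0 ≤ Lf) (hLdf : 0 ≤ Ldf)
    (hdiff : Differentiable ℝ f)
    (hfLip : ∀ a b, ‖f a - f b‖ ≤ Lf * ‖a - b‖)
    (hdfLip : ∀ a b, ‖fderiv ℝ f a - fderiv ℝ f b‖ ≤ Ldf * ‖a - b‖)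
    (τ : ℝ) (hτ0 : 0 < τ) (hτ1 : τ ≤ 1)
    (v v' : E) (w G : H) (J : E →L[ℝ] H)
    (e : H) (he : e = f v - G)
    (ehat : E →L[ℝ] H) (hehat : ehat = fderiv ℝ f v - J)
    (Ahat : H) (hAhat : Ahat = f v' - f v - fderiv ℝ f v (v' - v))
    (w' : H) (hw' : w' = (1 - τ) • w + τ • G + J (v' - v))
    (rdot : ℝ)
    (hrdot : rdot =
      2 * τ * ⟪e, Ahat + (1 - τ) • (f v - w) + ehat (v' - v)⟫ +
        2 * ⟪ehat (v' - v), Ahat + (1 - τ) • (f v - w)⟫) :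
    ‖f v' - w'‖ ^ 2 ≤
      (1 - τ) * ‖f v - w‖ ^ 2 + τ ^ 2 * ‖e‖ ^ 2 + rdot +
        (8 * Lf ^ 2 + Ldf * ‖f v - w‖ + ‖ehat‖ ^ 2) * ‖v' - v‖ ^ 2 := by
  have hquad : ‖Ahat‖ ≤ Ldf / 2 * ‖v' - v‖ ^ 2 :=
    hAhat ▸ norm_sub_sub_fderiv_le_of_fderiv_lipschitz hdiff hdfLip v v'
  have hlin : ‖Ahat‖ ≤ 2 * Lf * ‖v' - v‖ :=
    hAhat ▸ norm_sub_sub_fderiv_le_of_lipschitz hLf hfLip v v'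
  have hop : ‖ehat (v' - v)‖ ≤ ‖ehat‖ * ‖v' - v‖ := ehat.le_opNorm _
  have hsplit : f v' - w' = (Ahat + (1 - τ) • (f v - w)) + ehat (v' - v) + τ • e := by
    rw [hw', hAhat, hehat, he, sub_apply]
    module
  set u := f v - w
  set q := ehat (v' - v)
  set n := ‖v' - v‖
  have hexpand : ‖f v' - w'‖ ^ 2 =
      ‖Ahat‖ ^ 2 + 2 * (1 - τ) * ⟪Ahat, u⟫ + (1 - τ) ^ 2 * ‖u‖ ^ 2 + ‖q‖ ^ 2
        + τ ^ 2 * ‖e‖ ^ 2 + rdot := by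
    rw [hsplit, hrdot, norm_add_sq_real, norm_add_sq_real, norm_add_sq_real, norm_smul, norm_smul,
      mul_pow, mul_pow, Real.norm_eq_abs, Real.norm_eq_abs, sq_abs, sq_abs,
      real_inner_smul_right, real_inner_smul_right, real_inner_comm e,
      real_inner_comm q]
    ring
  have hA : ‖Ahat‖ ^ 2 ≤ 8 * Lf ^ 2 * n ^ 2 := by
    have := pow_le_pow_left₀ (norm_nonneg _) hlin 2
    nlinarith [sq_nonneg (Lf * n)]
  have hq : ‖q‖ ^ 2 ≤ ‖ehat‖ ^ 2 * n ^ 2 := by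
    simpa [mul_pow] using pow_le_pow_left₀ (norm_nonneg _) hop 2
  have hcross : 2 * (1 - τ) * ⟪Ahat, u⟫ ≤ Ldf * ‖u‖ * n ^ 2 :=
    calc 2 * (1 - τ) * ⟪Ahat, u⟫ ≤ 2 * (1 - τ) * (‖Ahat‖ * ‖u‖) :=
          mul_le_mul_of_nonneg_left (real_inner_le_norm _ _) (by linarith)
      _ ≤ 2 * (‖Ahat‖ * ‖u‖) := mul_le_mul_of_nonneg_right (by linarith) (by positivity)
      _ ≤ 2 * (Ldf / 2 * n ^ 2 * ‖u‖) := by gcongr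
      _ = Ldf * ‖u‖ * n ^ 2 := by ring
  have hu : (1 - τ) ^ 2 * ‖u‖ ^ 2 ≤ (1 - τ) * ‖u‖ ^ 2 :=
    mul_le_mul_of_nonneg_right (by nlinarith) (sq_nonneg _)
  rw [hexpand]
  linarith
end
end

section
/- Let E and H be real inner product spaces, let f : E → H be any map, let τ ∈ (0, 1], v, v' ∈ E, w, G ∈ H, and let J : E → H be a continuous linear map with operator norm ‖J‖. Define e = f(v) − G, w' = (1 − τ)w + τG + J(v' − v), and r̈ = τ⟨−e, τ(f(v) − w) + J(v' − v)⟩. Then ‖w' − w‖² ≤ τ²[2‖f(v) − w‖² + ‖e‖²] + 2‖J‖²‖v' − v‖² + 2r̈. -/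
open scoped RealInnerProductSpace

noncomputable section

/-- Increment estimate of Lemma 3.1(b) of the paper for the linearized moving-average update:
with `e = f(v) − G`, `w' = (1 − τ)w + τG + J(v' − v)`, and
`r̈ = τ⟨−e, τ(f(v) − w) + J(v' − v)⟩`, one has
`‖w' − w‖² ≤ τ²[2‖f(v) − w‖² + ‖e‖²] + 2‖J‖²‖v' − v‖² + 2r̈`. -/
theorem stmt17
    (E H : Type) [NormedAddCommGroup E] [InnerProductSpace ℝ E]
    [NormedAddCommGroup H] [InnerProductSpace ℝ H]
    (f : E → H)
    (τ : ℝ) (hτ0 : 0 < τ) (hτ1 : τ ≤ 1)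
    (v v' : E) (w G : H) (J : E →L[ℝ] H)
    (e : H) (he : e = f v - G)
    (w' : H) (hw' : w' = (1 - τ) • w + τ • G + J (v' - v))
    (rddot : ℝ) (hrddot : rddot = τ * ⟪-e, τ • (f v - w) + J (v' - v)⟫) :
    ‖w' - w‖ ^ 2 ≤
      τ ^ 2 * (2 * ‖f v - w‖ ^ 2 + ‖e‖ ^ 2) + 2 * ‖J‖ ^ 2 * ‖v' - v‖ ^ 2 + 2 * rddot := by
  have increment_eq : w' - w = (τ • (f v - w) + J (v' - v)) - τ • e := by
    rw [hw', he]
    module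
  have norm_J_sq : ‖J (v' - v)‖ ^ 2 ≤ ‖J‖ ^ 2 * ‖v' - v‖ ^ 2 := by
    rw [← mul_pow]
    gcongr
    exact J.le_opNorm _
  have drift_sq : ‖τ • (f v - w) + J (v' - v)‖ ^ 2 ≤
      2 * (τ ^ 2 * ‖f v - w‖ ^ 2) + 2 * ‖J (v' - v)‖ ^ 2 := by
    have parallelogram := parallelogram_law_with_norm ℝ (τ • (f v - w)) (J (v' - v))
    have smul_sq : ‖τ • (f v - w)‖ ^ 2 = τ ^ 2 * ‖f v - w‖ ^ 2 := by
      rw [norm_smul, mul_pow, Real.norm_eq_abs, sq_abs]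
    nlinarith [sq_nonneg ‖τ • (f v - w) - J (v' - v)‖]
  rw [increment_eq, norm_sub_sq_real, hrddot, inner_neg_left, real_inner_smul_right,
    real_inner_comm, norm_smul, mul_pow, Real.norm_eq_abs, sq_abs]
  linarith
end
end
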